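/- arXiv:1611.08190 — 3 statements merged into one kernel-verified Lean document; each statement's English description precedes it below -/
import Mathlib

section
/- Let A ∈ SO₀(1,2) be parabolic. Then ker(A - I) is a one-dimensional subspace spanned by a lightlike vector, the linear map A - I : ℝ³ → ℝ³ has rank 2, and the image of A - I equals the Minkowski-orthogonal complement of ker(A - I), i.e. Im(A - I) = {v ∈ ℝ³ : ⟨v,w⟩ = 0 for all w ∈ ker(A - I)}. -/
noncomputable section

/-- Points/vectors of Minkowski space `E^{1,2}`. -/
abbrev V3 : Type := Fin 3 → ℝ

/-- The Minkowski bilinear form `⟨·,·⟩` of signature `(1,2)`. -/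
def mb (v w : V3) : ℝ := -(v 0 * w 0) + v 1 * w 1 + v 2 * w 2

/-- The Minkowski quadratic form. -/
def mq (v : V3) : ℝ := mb v v

def futureTimelike (v : V3) : Prop := mq v < 0 ∧ 0 < v 0
def futureLightlike (v : V3) : Prop := mq v = 0 ∧ 0 < v 0
def futureCausal (v : V3) : Prop := mq v ≤ 0 ∧ 0 < v 0

/-- `SO₀(1,2)`: linear maps preserving the form, of determinant one,
preserving the future causal cone. -/
def SO12 : Set (Matrix (Fin 3) (Fin 3) ℝ) :=
  {A | (∀ v w, mb (A.mulVec v) (A.mulVec w) = mb v w) ∧ A.det = 1 ∧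
       ∀ v, futureCausal v → futureCausal (A.mulVec v)}

/-- A parabolic element of `SO₀(1,2)`. -/
def IsParabolic (A : Matrix (Fin 3) (Fin 3) ℝ) : Prop := A ≠ 1 ∧ (A - 1) ^ 3 = 0

/-- An (affine) isometry of `E^{1,2}` given by its linear part and translation part. -/
abbrev IsomE : Type := Matrix (Fin 3) (Fin 3) ℝ × V3

/-- The action of an isometry on `ℝ³`: `φ(x) = φ_L x + τ_φ`. -/
def isomApp (g : IsomE) (x : V3) : V3 := g.1.mulVec x + g.2

/-- Composition of isometries. -/
def isomMul (g h : IsomE) : IsomE := (g.1 * h.1, g.1.mulVec h.2 + g.2)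

/-- Iterated composition. -/
def isomPow (g : IsomE) : ℕ → IsomE
  | 0 => (1, 0)
  | n + 1 => isomMul g (isomPow g n)

/-- `G` is a subgroup of `Isom(E^{1,2})`. -/
def IsIsomSubgroup (G : Set IsomE) : Prop :=
  (∀ g ∈ G, g.1 ∈ SO12) ∧ ((1 : Matrix (Fin 3) (Fin 3) ℝ), (0 : V3)) ∈ G ∧
  (∀ g ∈ G, ∀ h ∈ G, isomMul g h ∈ G) ∧
  (∀ g ∈ G, ∃ h ∈ G, isomMul g h = (1, 0) ∧ isomMul h g = (1, 0))

/-- `G` is torsionfree: its only element of finite order is the identity. -/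
def IsomTorsionfree (G : Set IsomE) : Prop :=
  ∀ g ∈ G, ∀ n : ℕ, 0 < n → isomPow g n = (1, 0) → g = (1, 0)

/-- The chronological future of the lightlike plane `{x | ⟨x,u⟩ = c}`. -/
def futurePlane (u : V3) (c : ℝ) : Set V3 := {x | mb x u < c}

/-- A regular domain: a nonempty intersection of futures of lightlike planes. -/
def IsRegularDomain (Ω : Set V3) : Prop :=
  Ω.Nonempty ∧ ∃ Λ : Set (V3 × ℝ), Λ.Nonempty ∧ (∀ p ∈ Λ, futureLightlike p.1) ∧
    Ω = ⋂ p ∈ Λ, futurePlane p.1 p.2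

/-- The lightlike line `a + ℝ u`. -/
def linePts (a u : V3) : Set V3 := {x | ∃ s : ℝ, x = a + s • u}

/-- Fixed-point set of an isometry. -/
def FixSet (g : IsomE) : Set V3 := {x | isomApp g x = x}


lemma mb_add_left (x y z : V3) : mb (x + y) z = mb x z + mb y z := by
  simp only [mb, Pi.add_apply]; ring

lemma mb_smul_left (c : ℝ) (x z : V3) : mb (c • x) z = c * mb x z := by
  simp only [mb, Pi.smul_apply, smul_eq_mul]; ring

lemma mb_smul_right (c : ℝ) (x z : V3) : mb x (c • z) = c * mb x z := by
  simp only [mb, Pi.smul_apply, smul_eq_mul]; ring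

lemma mb_zero_right (x : V3) : mb x 0 = 0 := by simp [mb]

/-- The Minkowski form is nondegenerate. -/
lemma eq_zero_of_forall_mb_eq_zero {u : V3} (h : ∀ w, mb w u = 0) : u = 0 := by
  have h0 := h ![1, 0, 0]
  have h1 := h ![0, 1, 0]
  have h2 := h ![0, 0, 1]
  simp [mb] at h0 h1 h2
  ext i
  fin_cases i <;> simp [h0, h1, h2]

/-- Orthogonal isotropic vectors are proportional. -/
lemma exists_eq_smul_of_isotropic {u w : V3} (hu0 : u ≠ 0) (hu : mb u u = 0)
    (hw : mb w w = 0) (huw : mb u w = 0) : ∃ c : ℝ, w = c • u := by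
  simp only [mb] at hu hw huw
  have ht : u 0 ≠ 0 := by
    intro h
    rw [h] at hu
    apply hu0
    ext i
    fin_cases i
    · exact h
    · change u 1 = 0
      nlinarith [sq_nonneg (u 1), sq_nonneg (u 2)]
    · change u 2 = 0
      nlinarith [sq_nonneg (u 1), sq_nonneg (u 2)]
  obtain ⟨c, hc⟩ : ∃ c, w 0 = c * u 0 := ⟨w 0 / u 0, by field_simp⟩
  have key : (w 1 - c * u 1) ^ 2 + (w 2 - c * u 2) ^ 2 = 0 := by
    rw [hc] at hw huw
    linear_combination hw - 2 * c * huw + c ^ 2 * hu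
  refine ⟨c, ?_⟩
  ext i
  fin_cases i
  · exact hc
  · change w 1 = c * u 1
    nlinarith [sq_nonneg (w 1 - c * u 1), sq_nonneg (w 2 - c * u 2)]
  · change w 2 = c * u 2
    nlinarith [sq_nonneg (w 1 - c * u 1), sq_nonneg (w 2 - c * u 2)]

/-- If `I + N` is a Minkowski isometry and `N ^ 2 = 0`, then `N = 0`. -/
lemma eq_zero_of_sq_eq_zero {N : V3 →ₗ[ℝ] V3}
    (h : ∀ v w, mb (N v) (N w) + mb (N v) w + mb v (N w) = 0)
    (hN : ∀ v, N (N v) = 0) (v : V3) : N v = 0 := by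
  have iso (x y : V3) : mb (N x) (N y) = 0 := by
    simpa [hN, mb_zero_right] using h x (N y)
  have skew (x y : V3) : mb (N x) y + mb x (N y) = 0 := by
    simpa [iso] using h x y
  by_contra hv
  have comm (x y : V3) : mb x y = mb y x := by simp only [mb]; ring
  have hvu : mb v (N v) = 0 := by
    have := skew v v
    rw [comm (N v) v] at this
    linarith
  refine hv (eq_zero_of_forall_mb_eq_zero fun w => ?_)
  obtain ⟨c, hc⟩ := exists_eq_smul_of_isotropic hv (iso v v) (iso w w) (iso v w)
  have := skew v w
  rw [hc, mb_smul_right, hvu] at this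
  rw [comm]
  linarith

/-- A cyclic vector of a nilpotent endomorphism of `ℝ³` generates it. -/
lemma exists_eq_combination_of_nilpotent {N : V3 →ₗ[ℝ] V3} {v : V3}
    (h3 : N (N (N v)) = 0) (h2 : N (N v) ≠ 0) (p : V3) :
    ∃ a b c : ℝ, p = a • v + b • N v + c • N (N v) := by
  have li : LinearIndependent ℝ ![v, N v, N (N v)] := by
    rw [Fintype.linearIndependent_iff]
    intro g hg
    simp only [Fin.sum_univ_three, Matrix.cons_val] at hg
    have g0 : g 0 = 0 := by
      have := congrArg (fun x => N (N x)) hg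
      simpa [h3, h2] using this
    have g1 : g 1 = 0 := by
      have := congrArg N hg
      simpa [h3, h2, g0] using this
    have g2 : g 2 = 0 := by simpa [h2, g0, g1] using hg
    intro i
    fin_cases i <;> assumption
  have hp : p ∈ Submodule.span ℝ (Set.range ![v, N v, N (N v)]) := by
    rw [li.span_eq_top_of_card_eq_finrank (by simp)]
    trivial
  obtain ⟨g, hg⟩ := (Submodule.mem_span_range_iff_exists_fun ℝ).1 hp
  refine ⟨g 0, g 1, g 2, ?_⟩
  rw [← hg]
  simp [Fin.sum_univ_three]

/-- For a parabolic `A ∈ SO₀(1,2)`: `ker (A - I)` is spanned by a lightlike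
vector, `A - I` has rank `2`, and `Im (A - I)` is the Minkowski-orthogonal
complement of `ker (A - I)`. -/
theorem stmt1 (A : Matrix (Fin 3) (Fin 3) ℝ) (hA : A ∈ SO12) (hpar : IsParabolic A) :
    (∃ u : V3, u ≠ 0 ∧ mq u = 0 ∧
        LinearMap.ker (A - 1).mulVecLin = Submodule.span ℝ {u}) ∧
    Module.finrank ℝ ↥(LinearMap.range (A - 1).mulVecLin) = 2 ∧
    (LinearMap.range (A - 1).mulVecLin : Set V3) =
      {v | ∀ w, (A - 1).mulVecLin w = 0 → mb v w = 0} := by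
  obtain ⟨hiso, -, -⟩ := hA
  obtain ⟨hne, hcube⟩ := hpar
  have happ (v : V3) : (A - 1).mulVecLin v = A.mulVec v - v := by
    simp
  have hmb (v w : V3) : mb ((A - 1).mulVecLin v) ((A - 1).mulVecLin w) +
      mb ((A - 1).mulVecLin v) w + mb v ((A - 1).mulVecLin w) = 0 := by
    have := hiso v w
    rw [happ, happ]
    simp only [mb, Pi.sub_apply] at this ⊢
    linear_combination this
  have h3 (v : V3) :
      (A - 1).mulVecLin ((A - 1).mulVecLin ((A - 1).mulVecLin v)) = 0 := by
    simp only [Matrix.mulVecLin_apply, Matrix.mulVec_mulVec]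
    rw [← pow_three, hcube, Matrix.zero_mulVec]
  have hN0 : (A - 1).mulVecLin ≠ 0 := by
    intro h
    apply hne
    rw [← sub_eq_zero]
    exact Matrix.mulVec_injective (funext fun v => by
      simpa only [Matrix.mulVecLin_apply, LinearMap.zero_apply, Matrix.zero_mulVec] using
        LinearMap.congr_fun h v)
  generalize (A - 1).mulVecLin = N at *
  obtain ⟨v, hv⟩ : ∃ v, N (N v) ≠ 0 := by
    by_contra! h
    exact hN0 (LinearMap.ext fun x => eq_zero_of_sq_eq_zero hmb h x)
  have hker : LinearMap.ker N = Submodule.span ℝ {N (N v)} := by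
    ext p
    rw [LinearMap.mem_ker, Submodule.mem_span_singleton]
    constructor
    · intro hp
      obtain ⟨a, b, c, rfl⟩ := exists_eq_combination_of_nilpotent (h3 v) hv p
      have ha : a = 0 := by
        have := congrArg N hp
        simpa [h3, hv] using this
      have hb : b = 0 := by simpa [h3, hv, ha] using hp
      exact ⟨c, by simp [ha, hb]⟩
    · rintro ⟨c, rfl⟩
      simp [h3]
  have horth (x w : V3) (hw : N w = 0) : mb (N x) w = 0 := by
    simpa [hw, mb_zero_right] using hmb x w
  refine ⟨⟨N (N v), hv, horth _ _ (h3 v), hker⟩, ?_, ?_⟩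
  · have := N.finrank_range_add_finrank_ker
    rw [hker, finrank_span_singleton hv, Module.finrank_fin_fun] at this
    lia
  · ext p
    constructor
    · rintro ⟨x, rfl⟩ w hw
      exact horth x w hw
    · intro hp
      have hpu : mb p (N (N v)) = 0 := hp _ (h3 v)
      have hvu : mb v (N (N v)) ≠ 0 := by
        intro h
        refine hv (eq_zero_of_forall_mb_eq_zero fun w => ?_)
        obtain ⟨a, b, c, rfl⟩ := exists_eq_combination_of_nilpotent (h3 v) hv w
        simp [mb_add_left, mb_smul_left, h, horth _ _ (h3 v)]
      obtain ⟨a, b, c, rfl⟩ := exists_eq_combination_of_nilpotent (h3 v) hv p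
      have ha : a = 0 := by
        simpa [mb_add_left, mb_smul_left, hvu, horth _ _ (h3 v)] using hpu
      exact ⟨b • v + c • N v, by simp [ha]⟩
end
end

section
/- Let (u₁,u₂,u₃) and (v₁,v₂,v₃) be two triples of pairwise linearly independent future lightlike vectors in ℝ³ such that det(u₁,u₂,u₃) and det(v₁,v₂,v₃) have the same sign. Then there exists a unique A ∈ SO₀(1,2) such that for each i ∈ {1,2,3} there is a real number λᵢ > 0 with A(uᵢ) = λᵢ·vᵢ. -/
noncomputable section

theorem mb_comm (x y : V3) : mb x y = mb y x := by
  simp only [mb]; ring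

theorem mb_smul_smul (a b : ℝ) (x y : V3) : mb (a • x) (b • y) = a * b * mb x y := by
  simp only [mb, Pi.smul_apply, smul_eq_mul]; ring

theorem mq_smul_add_smul (a b : ℝ) (x y : V3) :
    mq (a • x + b • y) = a ^ 2 * mq x + b ^ 2 * mq y + 2 * (a * b) * mb x y := by
  simp only [mq, mb, Pi.add_apply, Pi.smul_apply, smul_eq_mul]; ring

/-- Linearly independent future lightlike vectors have negative product. -/
theorem mb_neg_of_futureLightlike {x y : V3} (hx : futureLightlike x) (hy : futureLightlike y)
    (h : ∀ a b : ℝ, a • x + b • y = 0 → a = 0 ∧ b = 0) : mb x y < 0 := by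
  obtain ⟨hx, hx0⟩ := hx
  obtain ⟨hy, hy0⟩ := hy
  simp only [mq, mb] at hx hy ⊢
  have hp : 0 < x 0 * y 0 := mul_pos hx0 hy0
  have hlagrange : (x 1 * y 1 + x 2 * y 2) ^ 2 + (x 1 * y 2 - x 2 * y 1) ^ 2
      = (x 0 * y 0) ^ 2 := by
    linear_combination (y 1 ^ 2 + y 2 ^ 2) * hx + x 0 ^ 2 * hy
  by_contra! hc
  have hcross : x 1 * y 2 - x 2 * y 1 = 0 := by
    have : (x 1 * y 2 - x 2 * y 1) ^ 2 ≤ 0 := by nlinarith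
    exact pow_eq_zero_iff two_ne_zero |>.1 (le_antisymm this (sq_nonneg _))
  have hdot : x 1 * y 1 + x 2 * y 2 = x 0 * y 0 := by
    rw [hcross] at hlagrange
    nlinarith
  have h1 : y 0 * x 1 - x 0 * y 1 = 0 := by
    apply (mul_eq_zero_iff_left hx0.ne').1
    linear_combination (-x 1) * hdot + y 1 * hx + x 2 * hcross
  have h2 : y 0 * x 2 - x 0 * y 2 = 0 := by
    apply (mul_eq_zero_iff_left hx0.ne').1
    linear_combination (-x 2) * hdot + y 2 * hx - x 1 * hcross
  refine hy0.ne' (h (y 0) (-x 0) ?_).1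
  ext i
  fin_cases i <;> simp <;> linarith

theorem futureTimelike_add {x y : V3} (hx : futureLightlike x) (hy : futureLightlike y)
    (hxy : mb x y < 0) {a b : ℝ} (ha : 0 < a) (hb : 0 < b) :
    futureTimelike (a • x + b • y) := by
  refine ⟨?_, ?_⟩
  · rw [mq_smul_add_smul, hx.1, hy.1]
    have := mul_pos ha hb
    nlinarith
  · have := mul_pos ha hx.2
    have := mul_pos hb hy.2
    simp only [Pi.add_apply, Pi.smul_apply, smul_eq_mul]
    linarith

/-- A vector in the closed causal future has nonpositive product with a future timelike one. -/
theorem mb_nonpos {x y : V3} (hx : mq x ≤ 0) (hx0 : 0 ≤ x 0) (hy : futureTimelike y) :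
    mb x y ≤ 0 := by
  obtain ⟨hy, hy0⟩ := hy
  simp only [mq, mb] at hx hy ⊢
  have : x 1 * y 1 + x 2 * y 2 ≤ x 0 * y 0 := by
    apply abs_le_of_sq_le_sq' _ (by positivity) |>.2
    nlinarith [sq_nonneg (x 1 * y 2 - x 2 * y 1), mul_nonneg (sq_nonneg (x 0)) (sub_nonneg.2 hy.le),
      mul_nonneg (add_nonneg (sq_nonneg (y 1)) (sq_nonneg (y 2))) (sub_nonneg.2 hx)]
  linarith

theorem mb_neg_of_futureCausal {x y : V3} (hx : futureCausal x) (hy : futureTimelike y) :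
    mb x y < 0 := by
  obtain ⟨hx, hx0⟩ := hx
  obtain ⟨hy, hy0⟩ := hy
  simp only [mq, mb] at hx hy ⊢
  have : x 1 * y 1 + x 2 * y 2 < x 0 * y 0 := by
    apply lt_of_pow_lt_pow_left₀ 2 (by positivity)
    nlinarith [sq_nonneg (x 1 * y 2 - x 2 * y 1), mul_pos (pow_pos hx0 2) (sub_pos.2 hy),
      mul_nonneg (add_nonneg (sq_nonneg (y 1)) (sq_nonneg (y 2))) (sub_nonneg.2 hx)]
  linarith

/-- A form-preserving map is future-preserving once it sends one future timelike vector to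
another. -/
theorem futureCausal_mulVec {A : Matrix (Fin 3) (Fin 3) ℝ}
    (hA : ∀ x y, mb (A.mulVec x) (A.mulVec y) = mb x y) {w : V3} (hw : futureTimelike w)
    (hAw : futureTimelike (A.mulVec w)) {x : V3} (hx : futureCausal x) :
    futureCausal (A.mulVec x) := by
  have hq : mq (A.mulVec x) ≤ 0 := (hA x x).trans_le hx.1
  refine ⟨hq, ?_⟩
  by_contra! h0
  have hneg := mb_neg_of_futureCausal hx hw
  have hq' : mq (-A.mulVec x) ≤ 0 := by
    simpa [mq, mb] using hq
  have hpos := mb_nonpos hq' (by simpa using h0) hAw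
  rw [← hA] at hneg
  simp only [mb, Pi.neg_apply] at hneg hpos
  linarith

/-- The Gram matrix of the Minkowski form in the standard basis. -/
def minkowskiGram : Matrix (Fin 3) (Fin 3) ℝ := Matrix.diagonal ![-1, 1, 1]

theorem det_minkowskiGram : minkowskiGram.det = -1 := by
  simp [minkowskiGram, Fin.prod_univ_three]

open Matrix in
theorem mb_eq_dotProduct (x y : V3) : mb x y = x ⬝ᵥ (minkowskiGram *ᵥ y) := by
  simp [mb, minkowskiGram, Matrix.mulVec_diagonal, dotProduct, Fin.sum_univ_three]

open Matrix in
theorem mb_mulVec (A : Matrix (Fin 3) (Fin 3) ℝ) (x y : V3) :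
    mb (A *ᵥ x) (A *ᵥ y) = x ⬝ᵥ ((Aᵀ * minkowskiGram * A) *ᵥ y) := by
  rw [mb_eq_dotProduct, ← Matrix.mulVec_mulVec, ← Matrix.mulVec_mulVec,
    Matrix.dotProduct_mulVec x, Matrix.vecMul_transpose]

open Matrix in
theorem transpose_mul_minkowskiGram_mul_apply (w : Fin 3 → V3) (i j : Fin 3) :
    ((Matrix.of fun a b => w b a)ᵀ * minkowskiGram * Matrix.of fun a b => w b a) i j
      = mb (w i) (w j) := by
  simp [mb, minkowskiGram, Matrix.mul_apply, Fin.sum_univ_three, Matrix.diagonal]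

/-- A matrix preserving the products of a basis preserves the form. -/
theorem transpose_mul_minkowskiGram_mul_eq {A : Matrix (Fin 3) (Fin 3) ℝ} {u w : Fin 3 → V3}
    (hu : (Matrix.of fun i j => u j i).det ≠ 0)
    (hAu : A * Matrix.of (fun i j => u j i) = Matrix.of fun i j => w j i)
    (h : ∀ i j, mb (w i) (w j) = mb (u i) (u j)) :
    A.transpose * minkowskiGram * A = minkowskiGram := by
  have hU := (Matrix.isUnit_iff_isUnit_det _).2 (isUnit_iff_ne_zero.2 hu)
  have hUt := (Matrix.isUnit_transpose _).2 hU
  apply hU.mul_right_cancel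
  apply hUt.mul_left_cancel
  ext i j
  have hw := transpose_mul_minkowskiGram_mul_apply w i j
  rw [← hAu, h, ← transpose_mul_minkowskiGram_mul_apply u, Matrix.transpose_mul] at hw
  simpa only [Matrix.mul_assoc] using hw

theorem exists_pos_pairwise_mul {p q r : ℝ} (hp : 0 < p) (hq : 0 < q) (hr : 0 < r) :
    ∃ x y z : ℝ, 0 < x ∧ 0 < y ∧ 0 < z ∧ x * y = r ∧ x * z = q ∧ y * z = p := by
  have hpos : 0 < q * r / p := by positivity
  have hx := Real.sqrt_pos.2 hpos
  have hsq := Real.sq_sqrt hpos.le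
  refine ⟨√(q * r / p), r / √(q * r / p), q / √(q * r / p), hx, by positivity, by positivity,
    by field_simp, by field_simp, ?_⟩
  rw [div_mul_div_comm, ← sq, hsq]
  field_simp

theorem eq_of_pairwise_mul_eq {x y z x' y' z' : ℝ} (hx : 0 < x) (hy : 0 < y) (hz : 0 < z)
    (hx' : 0 < x') (hxy : x * y = x' * y') (hxz : x * z = x' * z') (hyz : y * z = y' * z') :
    x = x' := by
  have h : x ^ 2 * (y * z) = x' ^ 2 * (y * z) := by
    linear_combination x * z * hxy + x' * y' * hxz - x' ^ 2 * hyz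
  exact (pow_left_inj₀ hx.le hx'.le two_ne_zero).1 (mul_right_cancel₀ (mul_pos hy hz).ne' h)

/-- Given two triples of pairwise linearly independent future lightlike vectors
whose determinants have the same sign, there is a unique element of `SO₀(1,2)`
mapping each `uᵢ` onto the ray `ℝ₊·vᵢ`. -/
theorem stmt5 (u v : Fin 3 → V3)
    (hu : ∀ i, futureLightlike (u i)) (hv : ∀ i, futureLightlike (v i))
    (huind : ∀ i j, i ≠ j → ∀ a b : ℝ, a • u i + b • u j = 0 → a = 0 ∧ b = 0)
    (hvind : ∀ i j, i ≠ j → ∀ a b : ℝ, a • v i + b • v j = 0 → a = 0 ∧ b = 0)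
    (hdet : 0 < (Matrix.of fun i j => u j i).det * (Matrix.of fun i j => v j i).det) :
    ∃! A : Matrix (Fin 3) (Fin 3) ℝ, A ∈ SO12 ∧
      ∀ i, ∃ lam : ℝ, 0 < lam ∧ A.mulVec (u i) = lam • v i := by
  have hun : ∀ i j, i ≠ j → mb (u i) (u j) < 0 := fun i j hij =>
    mb_neg_of_futureLightlike (hu i) (hu j) (huind i j hij)
  have hvn : ∀ i j, i ≠ j → mb (v i) (v j) < 0 := fun i j hij =>
    mb_neg_of_futureLightlike (hv i) (hv j) (hvind i j hij)
  have hU : (Matrix.of fun i j => u j i).det ≠ 0 := left_ne_zero_of_mul hdet.ne'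
  have hUunit := (Matrix.isUnit_iff_isUnit_det _).2 (isUnit_iff_ne_zero.2 hU)
  have hcol (A : Matrix (Fin 3) (Fin 3) ℝ) :
      A * Matrix.of (fun i j => u j i) = Matrix.of fun i j => A.mulVec (u j) i := by
    ext i j
    simp [Matrix.mul_apply, Matrix.mulVec, dotProduct]
  apply existsUnique_of_exists_of_unique
  · have hratio : ∀ i j, i ≠ j → 0 < mb (u i) (u j) / mb (v i) (v j) := fun i j hij =>
      div_pos_of_neg_of_neg (hun i j hij) (hvn i j hij)
    obtain ⟨x, y, z, hx, hy, hz, hxy, hxz, hyz⟩ := exists_pos_pairwise_mul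
      (hratio 1 2 (by decide)) (hratio 0 2 (by decide)) (hratio 0 1 (by decide))
    rw [eq_div_iff (hvn _ _ (by decide)).ne] at hxy hxz hyz
    let l : Fin 3 → ℝ := ![x, y, z]
    have hl : ∀ i, 0 < l i := by
      intro i; fin_cases i <;> assumption
    have hgram : ∀ i j, mb (l i • v i) (l j • v j) = mb (u i) (u j) := by
      have hdiag (i) : mb (l i • v i) (l i • v i) = mb (u i) (u i) := by
        rw [mb_smul_smul]
        exact (mul_eq_zero_of_right _ (hv i).1).trans (hu i).1.symm
      have hsymm {i j} (h : mb (l i • v i) (l j • v j) = mb (u i) (u j)) :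
          mb (l j • v j) (l i • v i) = mb (u j) (u i) := by
        rw [mb_comm, h, mb_comm]
      have h01 : mb (l 0 • v 0) (l 1 • v 1) = mb (u 0) (u 1) := (mb_smul_smul ..).trans hxy
      have h02 : mb (l 0 • v 0) (l 2 • v 2) = mb (u 0) (u 2) := (mb_smul_smul ..).trans hxz
      have h12 : mb (l 1 • v 1) (l 2 • v 2) = mb (u 1) (u 2) := (mb_smul_smul ..).trans hyz
      intro i j
      fin_cases i <;> fin_cases j
      exacts [hdiag 0, h01, h02, hsymm h01, hdiag 1, h12, hsymm h02, hsymm h12, hdiag 2]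
    obtain ⟨A, hA⟩ : ∃ A : Matrix (Fin 3) (Fin 3) ℝ,
        A * Matrix.of (fun i j => u j i) = Matrix.of fun i j => (l j • v j) i :=
      ⟨_ * (Matrix.of fun i j => u j i)⁻¹,
        Matrix.nonsing_inv_mul_cancel_right _ _ (isUnit_iff_ne_zero.2 hU)⟩
    have hAu (i) : A.mulVec (u i) = l i • v i := by
      ext k
      exact congrFun (congrFun ((hcol A).symm.trans hA) k) i
    have hAJ := transpose_mul_minkowskiGram_mul_eq hU hA hgram
    have hAmb : ∀ x y, mb (A.mulVec x) (A.mulVec y) = mb x y := by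
      intro x y
      rw [mb_mulVec, hAJ, mb_eq_dotProduct]
    refine ⟨A, ⟨hAmb, ?_, fun x => futureCausal_mulVec hAmb (w := (1 : ℝ) • u 0 + (1 : ℝ) • u 1)
      (futureTimelike_add (hu 0) (hu 1) (hun 0 1 (by decide)) one_pos one_pos) ?_⟩,
      fun i => ⟨l i, hl i, hAu i⟩⟩
    · have hsq : A.det ^ 2 = 1 := by
        have := congrArg Matrix.det hAJ
        rw [Matrix.det_mul, Matrix.det_mul, Matrix.det_transpose, det_minkowskiGram] at this
        linarith
      have hmul : A.det * (Matrix.of fun i j => u j i).det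
          = (x * y * z) * (Matrix.of fun i j => v j i).det := by
        have hscale := Matrix.det_mul_row l (Matrix.of fun i j => v j i)
        rw [Fin.prod_univ_three] at hscale
        rw [← Matrix.det_mul, hA]
        exact hscale
      have hpos : 0 < A.det := by
        have hxyz : 0 < x * y * z := by positivity
        have : 0 < A.det * (Matrix.of fun i j => u j i).det ^ 2 := by
          calc 0 < (x * y * z) * ((Matrix.of fun i j => u j i).det *
                (Matrix.of fun i j => v j i).det) := mul_pos hxyz hdet
            _ = _ := by linear_combination (-(Matrix.of fun i j => u j i).det) * hmul
        exact pos_of_mul_pos_left this (sq_nonneg _)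
      exact (pow_eq_one_iff_of_nonneg hpos.le two_ne_zero).1 hsq
    · rw [Matrix.mulVec_add, one_smul, one_smul, hAu, hAu]
      exact futureTimelike_add (hv 0) (hv 1) (hvn 0 1 (by decide)) (hl 0) (hl 1)
  · rintro A B ⟨⟨hA, -⟩, hAu⟩ ⟨⟨hB, -⟩, hBu⟩
    choose l hl hAu using hAu
    choose m hm hBu using hBu
    have hlm : ∀ i j, i ≠ j → l i * l j = m i * m j := by
      intro i j hij
      apply mul_right_cancel₀ (hvn i j hij).ne
      rw [← mb_smul_smul, ← mb_smul_smul, ← hAu, ← hAu, ← hBu, ← hBu, hA, hB]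
    have heq : ∀ i, l i = m i := by
      have (i j k) (hij : i ≠ j) (hik : i ≠ k) (hjk : j ≠ k) : l i = m i :=
        eq_of_pairwise_mul_eq (hl i) (hl j) (hl k) (hm i) (hlm i j hij) (hlm i k hik) (hlm j k hjk)
      intro i
      fin_cases i
      · exact this 0 1 2 (by decide) (by decide) (by decide)
      · exact this 1 0 2 (by decide) (by decide) (by decide)
      · exact this 2 0 1 (by decide) (by decide) (by decide)
    apply hUunit.mul_right_cancel
    simp only [hcol, hAu, hBu, heq]
end
end

section
/- Let O ⊆ ℝ³ be open and f : ℝ³ → ℝ³ be C¹ on O. Let X = O ∩ ℍ², and assume that for every x ∈ X and every nonzero vector ξ ∈ ℝ³ with ⟨x,ξ⟩ = 0 one has ⟨Df_x(ξ), ξ⟩ > 0, where Df_x denotes the Fréchet derivative of f at x. Then f is locally divergent on X: for every p ∈ X there is a neighborhood U of p in ℍ² with U ⊆ X such that for all x, y ∈ U, ⟨f(x) - f(y), x + ⟨x,y⟩·y⟩ ≥ 0. -/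
noncomputable section

/-- The hyperboloid model `ℍ² ⊆ E^{1,2}`. -/
def Hyp2 : Set V3 := {x | mq x = -1 ∧ 0 < x 0}

theorem abs_mb_le (v w : V3) : |mb v w| ≤ 3 * ‖v‖ * ‖w‖ := by
  have h (i : Fin 3) : |v i * w i| ≤ ‖v‖ * ‖w‖ := by
    rw [abs_mul]
    exact mul_le_mul (norm_le_pi_norm v i) (norm_le_pi_norm w i) (abs_nonneg _) (norm_nonneg _)
  have h0 := abs_le.mp (h 0)
  have h1 := abs_le.mp (h 1)
  have h2 := abs_le.mp (h 2)
  unfold mb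
  rw [abs_le]
  constructor <;> linarith

theorem continuous_mb {X : Type*} [TopologicalSpace X] {g h : X → V3} (hg : Continuous g)
    (hh : Continuous h) : Continuous fun x => mb (g x) (h x) := by
  unfold mb
  fun_prop

theorem mb_smul_left_s8 (a : ℝ) (v w : V3) : mb (a • v) w = a * mb v w := by
  simp only [mb, Pi.smul_apply, smul_eq_mul]
  ring

theorem mb_smul_right_s8 (a : ℝ) (v w : V3) : mb v (a • w) = a * mb v w := by
  simp only [mb, Pi.smul_apply, smul_eq_mul]
  ring

theorem mb_add_left_s8 (u v w : V3) : mb (u + v) w = mb u w + mb v w := by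
  simp only [mb, Pi.add_apply]
  ring

theorem mb_add_right (u v w : V3) : mb u (v + w) = mb u v + mb u w := by
  simp only [mb, Pi.add_apply]
  ring

/-- Positivity of a quadratic form on `p^⊥` is quantitative: a vector which is not
uniformly transverse to `p^⊥` has uniformly positive image. -/
theorem exists_coercive (L : V3 →L[ℝ] V3) (p : V3)
    (hL : ∀ ξ : V3, ξ ≠ 0 → mb p ξ = 0 → 0 < mb (L ξ) ξ) :
    ∃ c > 0, ∀ v : V3, c * ‖v‖ ^ 2 ≤ mb (L v) v ∨ c * ‖v‖ ≤ |mb p v| := by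
  have hcont : Continuous fun v : V3 => max (mb (L v) v) |mb p v| :=
    (continuous_mb L.continuous continuous_id).max
      (continuous_mb continuous_const continuous_id).abs
  have hne : (Metric.sphere (0 : V3) 1).Nonempty := NormedSpace.sphere_nonempty.mpr zero_le_one
  obtain ⟨u, hu, hmin⟩ := (isCompact_sphere (0 : V3) 1).exists_isMinOn hne hcont.continuousOn
  have hu0 : u ≠ 0 := ne_zero_of_mem_unit_sphere ⟨u, hu⟩
  refine ⟨max (mb (L u) u) |mb p u|, ?_, fun v => ?_⟩
  · by_cases h : mb p u = 0
    · exact lt_max_of_lt_left (hL u hu0 h)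
    · exact lt_max_of_lt_right (abs_pos.mpr h)
  · rcases eq_or_ne v 0 with rfl | hv
    · right
      simp
    have hn : 0 < ‖v‖ := norm_pos_iff.mpr hv
    set c := max (mb (L u) u) |mb p u|
    set e : V3 := ‖v‖⁻¹ • v
    have he : e ∈ Metric.sphere (0 : V3) 1 := by
      simp [e, norm_smul, hn.ne']
    have hve : v = ‖v‖ • e := by
      simp [e, smul_smul, hn.ne']
    have hce : c ≤ max (mb (L e) e) |mb p e| := hmin he
    have hq : mb (L v) v = ‖v‖ ^ 2 * mb (L e) e := by
      conv_lhs => rw [hve, map_smul, mb_smul_left_s8, mb_smul_right_s8]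
      ring
    have hp : |mb p v| = ‖v‖ * |mb p e| := by
      conv_lhs => rw [hve, mb_smul_right_s8, abs_mul, abs_norm]
    rw [hq, hp, mul_comm c, mul_comm c]
    exact (le_max_iff.mp hce).imp (fun h => by gcongr) (fun h => by gcongr)

/-- A `C¹` direction field whose derivative satisfies `⟨Df_x ξ, ξ⟩ > 0` on
tangent vectors is locally divergent. -/
theorem stmt8 (O : Set V3) (hO : IsOpen O) (f : V3 → V3)
    (hf : ContDiffOn ℝ 1 f O)
    (hdiv : ∀ x ∈ O ∩ Hyp2, ∀ ξ : V3, ξ ≠ 0 → mb x ξ = 0 →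
      0 < mb (fderiv ℝ f x ξ) ξ) :
    ∀ p ∈ O ∩ Hyp2, ∃ U : Set V3, IsOpen U ∧ p ∈ U ∧ U ∩ Hyp2 ⊆ O ∩ Hyp2 ∧
      ∀ x ∈ U ∩ Hyp2, ∀ y ∈ U ∩ Hyp2,
        0 ≤ mb (f x - f y) (x + mb x y • y) := by
  rintro p ⟨hpO, hpH⟩
  set L := fderiv ℝ f p
  obtain ⟨c, hc, hcoer⟩ := exists_coercive L p (hdiv p ⟨hpO, hpH⟩)
  have hstrict : HasStrictFDerivAt f L p :=
    (hf.contDiffAt (hO.mem_nhds hpO)).hasStrictFDerivAt one_ne_zero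
  obtain ⟨s, hs, happrox⟩ := hstrict.approximates_deriv_on_nhds (c := (c / 6).toNNReal)
    (Or.inr (Real.toNNReal_pos.mpr (by positivity)))
  obtain ⟨ρ, hρ, hball⟩ := Metric.mem_nhds_iff.mp (Filter.inter_mem hs (hO.mem_nhds hpO))
  set K := ‖L‖ + c / 6
  set M := ‖p‖ + 1
  have hK : 0 < K := by positivity
  have hM : 0 < M := by positivity
  obtain ⟨r, hr, hr1⟩ : ∃ r > 0, r ≤ min (min ρ 1) (min (c / 6) (c / (18 * K * M))) :=
    ⟨_, by positivity, le_rfl⟩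
  simp only [le_min_iff] at hr1
  obtain ⟨⟨hrρ, hr1⟩, hrc, hrK⟩ := hr1
  rw [le_div_iff₀ (by positivity)] at hrK
  have hsub : Metric.ball p r ⊆ s ∩ O := (Metric.ball_subset_ball hrρ).trans hball
  refine ⟨Metric.ball p r, Metric.isOpen_ball, Metric.mem_ball_self hr,
    fun x hx => ⟨(hsub hx.1).2, hx.2⟩, ?_⟩
  rintro x ⟨hx, hxH⟩ y ⟨hy, hyH⟩
  set v := x - y with hv
  set e := f x - f y - L v with he
  have hxp : ‖x - p‖ < r := by simpa [dist_eq_norm] using hx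
  have hyp : ‖y - p‖ < r := by simpa [dist_eq_norm] using hy
  have hx1 : mb x x = -1 := hxH.1
  have hy1 : mb y y = -1 := hyH.1
  have hnv : ‖v‖ ≤ 2 * r := by
    have := norm_sub_le (x - p) (y - p)
    rw [sub_sub_sub_cancel_right] at this
    linarith
  have hny : ‖y‖ ≤ M := by
    have := norm_add_le (y - p) p
    rw [sub_add_cancel] at this
    simp only [M]
    linarith
  have hne : ‖e‖ ≤ c / 6 * ‖v‖ := by
    have := happrox x (hsub hx).1 y (hsub hy).1
    rwa [Real.coe_toNNReal _ (by positivity)] at this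
  have hfe : f x - f y = L v + e := by simp [he]
  rcases eq_or_ne v 0 with hv0 | hv0
  · rw [sub_eq_zero.mp hv0]
    simp [mb]
  have hn : 0 < ‖v‖ := norm_pos_iff.mpr hv0
  have hw : x + mb x y • y = v + (-(mb v v) / 2) • y := by
    have : mb v v = -2 - 2 * mb x y := by
      have : mb v v = mb x x + mb y y - 2 * mb x y := by
        simp only [hv, mb, Pi.sub_apply]
        ring
      linarith
    rw [this, hv]
    module
  have hpv : |mb p v| < c * ‖v‖ := by
    have h1 : mb p v = mb (p - (1 / 2 : ℝ) • (x + y)) v := by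
      have : mb (p - (1 / 2 : ℝ) • (x + y)) v = mb p v - (mb x x - mb y y) / 2 := by
        simp only [hv, mb, Pi.sub_apply, Pi.add_apply, Pi.smul_apply, smul_eq_mul]
        ring
      rw [this, hx1, hy1]
      ring
    have h2 : p - (1 / 2 : ℝ) • (x + y) = (-1 / 2 : ℝ) • ((x - p) + (y - p)) := by module
    have h3 : ‖p - (1 / 2 : ℝ) • (x + y)‖ ≤ r := by
      rw [h2, norm_smul]
      have := norm_add_le (x - p) (y - p)
      norm_num
      linarith
    rw [h1]
    calc _ ≤ 3 * ‖p - (1 / 2 : ℝ) • (x + y)‖ * ‖v‖ := abs_mb_le _ _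
      _ ≤ 3 * r * ‖v‖ := by gcongr
      _ < c * ‖v‖ := by
        gcongr
        linarith
  have hmain : c * ‖v‖ ^ 2 ≤ mb (L v) v := (hcoer v).resolve_right (not_le.mpr hpv)
  have herr1 : |mb e v| ≤ c / 2 * ‖v‖ ^ 2 :=
    calc _ ≤ 3 * ‖e‖ * ‖v‖ := abs_mb_le _ _
      _ ≤ 3 * (c / 6 * ‖v‖) * ‖v‖ := by gcongr
      _ = c / 2 * ‖v‖ ^ 2 := by ring
  have hLe : ‖L v + e‖ ≤ K * ‖v‖ :=
    calc _ ≤ ‖L v‖ + ‖e‖ := norm_add_le _ _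
      _ ≤ ‖L‖ * ‖v‖ + c / 6 * ‖v‖ := add_le_add (L.le_opNorm v) hne
      _ = K * ‖v‖ := by ring
  have herr2 : |-(mb v v) / 2 * mb (L v + e) y| ≤ c / 2 * ‖v‖ ^ 2 :=
    calc _ = |mb v v| / 2 * |mb (L v + e) y| := by rw [abs_mul, abs_div, abs_neg, abs_two]
      _ ≤ (3 * ‖v‖ * ‖v‖) / 2 * (3 * ‖L v + e‖ * ‖y‖) := by
        gcongr
        · exact abs_mb_le _ _
        · exact abs_mb_le _ _
      _ ≤ (3 * ‖v‖ * ‖v‖) / 2 * (3 * (K * (2 * r)) * M) := by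
        gcongr
        exact hLe.trans (by gcongr)
      _ = r * (18 * K * M) / 2 * ‖v‖ ^ 2 := by ring
      _ ≤ c / 2 * ‖v‖ ^ 2 := by gcongr
  rw [hfe, hw, mb_add_right, mb_smul_right_s8, mb_add_left_s8]
  have := neg_le_of_abs_le herr1
  have := neg_le_of_abs_le herr2
  linarith
end
end
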